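/- arXiv:2002.04006 — 2 statements merged into one kernel-verified Lean document; each statement's English description precedes it below -/
import Mathlib

section
/- Fix an integer k ≥ 1 and a symmetric configuration on [−1,1]. Then for every even integer i ≥ 0, ∫_{−1}^{1} x^{i}·(x − (Π id)(x)) dx = 0, where id(x) = x. Consequently, for every odd integer r ≥ 1, the configuration satisfies the k-r-order orthogonal condition if and only if it satisfies the k-(r+1)-order orthogonal condition. -/
open Polynomial

/-- The step interpolation: `(Πw)(x) = w (D m)` for `x ∈ (G m, G (m+1)]`. -/
noncomputable def stepInterp (k : ℕ) (G D : ℕ → ℝ) (w : ℝ → ℝ) (x : ℝ) : ℝ :=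
  ∑ m ∈ Finset.range (k + 1), if x ∈ Set.Ioc (G m) (G (m + 1)) then w (D m) else 0

/-- A symmetric configuration of dual points `G 1 < … < G k` (with `G 0 = -1`,
`G (k+1) = 1`) and interpolation nodes `D 0 = -1 < D 1 < … < D k = 1` on `[-1,1]`. -/
structure SymmConfig (k : ℕ) where
  G : ℕ → ℝ
  D : ℕ → ℝ
  G_zero : G 0 = -1
  G_last : G (k + 1) = 1
  G_mono : ∀ j ≤ k, G j < G (j + 1)
  G_symm : ∀ j, 1 ≤ j → j ≤ k → G j = -G (k + 1 - j)
  D_zero : D 0 = -1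
  D_last : D k = 1
  D_mono : ∀ j < k, D j < D (j + 1)
  D_symm : ∀ j ≤ k, D j = -D (k - j)

/-- The `k`-`r`-order orthogonal condition. -/
def OrthCond (k r : ℕ) (c : SymmConfig k) : Prop :=
  ∀ g w : Polynomial ℝ, g.degree ≤ (r : ℕ) → w.degree ≤ 1 →
    ∫ x in (-1:ℝ)..1,
      g.eval x * (w.eval x - stepInterp k c.G c.D (fun t => w.eval t) x) = 0

open MeasureTheory in
/-- An interval integral of an almost everywhere odd function over `[-a, a]` vanishes. -/
theorem intervalIntegral_eq_zero_of_ae_odd {h : ℝ → ℝ} (a : ℝ)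
    (hodd : ∀ᵐ x : ℝ, h (-x) = -h x) : ∫ x in (-a)..a, h x = 0 := by
  have h1 : ∫ x in (-a)..a, h (-x) = ∫ x in (-a)..a, h x := by
    rw [intervalIntegral.integral_comp_neg, neg_neg]
  have h2 : ∫ x in (-a)..a, h (-x) = ∫ x in (-a)..a, -h x :=
    intervalIntegral.integral_congr_ae (hodd.mono fun x hx _ => hx)
  rw [intervalIntegral.integral_neg] at h2
  linarith

namespace SymmConfig

variable {k : ℕ} (c : SymmConfig k)

theorem G_reflect (j : ℕ) (hj : j ≤ k + 1) : c.G j = -c.G (k + 1 - j) := by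
  rcases Nat.eq_zero_or_pos j with rfl | h0
  · simp [c.G_zero, c.G_last]
  · rcases hj.eq_or_lt with rfl | h1
    · simp [c.G_zero, c.G_last]
    · exact c.G_symm j h0 (by omega)

theorem G_zero_le (n : ℕ) (hn : n ≤ k + 1) : c.G 0 ≤ c.G n := by
  induction n with
  | zero => rfl
  | succ n ih => exact (ih (by omega)).trans (c.G_mono n (by omega)).le

theorem sum_indicator_Ioc (x : ℝ) (n : ℕ) (hn : n ≤ k + 1) :
    (∑ m ∈ Finset.range n, if x ∈ Set.Ioc (c.G m) (c.G (m + 1)) then (1 : ℝ) else 0) =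
      if x ∈ Set.Ioc (c.G 0) (c.G n) then 1 else 0 := by
  induction n with
  | zero => simp
  | succ n ih =>
    rw [Finset.sum_range_succ, ih (by omega)]
    have h0 := c.G_zero_le n (by omega)
    have h1 := c.G_mono n (by omega)
    simp only [Set.mem_Ioc]
    split_ifs <;> grind

theorem stepInterp_affine (a b : ℝ) {x : ℝ} (hx : x ∈ Set.Ioc (-1 : ℝ) 1) :
    stepInterp k c.G c.D (fun t => a + b * t) x =
      a + b * stepInterp k c.G c.D (fun t => t) x := by
  have h := c.sum_indicator_Ioc x (k + 1) le_rfl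
  rw [c.G_zero, c.G_last, if_pos hx] at h
  calc stepInterp k c.G c.D (fun t => a + b * t) x
      = a * (∑ m ∈ Finset.range (k + 1),
          if x ∈ Set.Ioc (c.G m) (c.G (m + 1)) then (1 : ℝ) else 0) +
        b * stepInterp k c.G c.D (fun t => t) x := by
        unfold stepInterp
        rw [Finset.mul_sum, Finset.mul_sum, ← Finset.sum_add_distrib]
        refine Finset.sum_congr rfl fun m _ => ?_
        split_ifs <;> simp
    _ = _ := by rw [h, mul_one]

/-- Away from the dual points, the step interpolation of the identity is odd. -/
theorem stepInterp_id_neg {x : ℝ} (hx : ∀ j ≤ k + 1, x ≠ c.G j) :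
    stepInterp k c.G c.D (fun t => t) (-x) = -stepInterp k c.G c.D (fun t => t) x := by
  unfold stepInterp
  rw [← Finset.sum_range_reflect, ← Finset.sum_neg_distrib]
  refine Finset.sum_congr rfl fun m hm => ?_
  have hm : m ≤ k := by simpa [Nat.lt_succ_iff] using hm
  have e0 : k + 1 - 1 - m = k - m := by omega
  have hD := c.D_symm (k - m) (by omega)
  have h1 := c.G_reflect (k - m) (by omega)
  have h2 := c.G_reflect (k - m + 1) (by omega)
  rw [show k - (k - m) = m by omega] at hD
  rw [show k + 1 - (k - m) = m + 1 by omega] at h1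
  rw [show k + 1 - (k - m + 1) = m by omega] at h2
  have n1 := hx m (by omega)
  have n2 := hx (m + 1) (by omega)
  have key : -x ∈ Set.Ioc (c.G (k - m)) (c.G (k - m + 1)) ↔
      x ∈ Set.Ioc (c.G m) (c.G (m + 1)) := by
    rw [h1, h2, Set.mem_Ioc, Set.mem_Ioc, neg_lt_neg_iff, neg_le_neg_iff]
    exact ⟨fun h => ⟨lt_of_le_of_ne h.2 n1.symm, h.1.le⟩,
      fun h => ⟨lt_of_le_of_ne h.2 n2, h.1.le⟩⟩
  simp only [e0, key, hD]
  split_ifs <;> simp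

open MeasureTheory in
theorem ae_stepInterp_id_neg :
    ∀ᵐ x : ℝ, stepInterp k c.G c.D (fun t => t) (-x) =
      -stepInterp k c.G c.D (fun t => t) x := by
  have h : ∀ᵐ x : ℝ, x ∉ c.G '' Set.Iic (k + 1) :=
    measure_eq_zero_iff_ae_notMem.1 (((Set.finite_Iic (k + 1)).image c.G).measure_zero volume)
  filter_upwards [h] with x hx
  exact c.stepInterp_id_neg fun j hj e => hx ⟨j, hj, e.symm⟩

theorem integral_even_pow_mul (i : ℕ) (hi : Even i) :
    ∫ x in (-1 : ℝ)..1, x ^ i * (x - stepInterp k c.G c.D (fun t => t) x) = 0 := by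
  refine intervalIntegral_eq_zero_of_ae_odd 1 ?_
  filter_upwards [c.ae_stepInterp_id_neg] with x hx
  rw [hx, hi.neg_pow]
  ring

end SymmConfig

open MeasureTheory in
theorem intervalIntegrable_stepInterp (k : ℕ) (G D : ℕ → ℝ) (w : ℝ → ℝ) (a b : ℝ) :
    IntervalIntegrable (stepInterp k G D w) volume a b := by
  have e : stepInterp k G D w = ∑ m ∈ Finset.range (k + 1),
      (Set.Ioc (G m) (G (m + 1))).indicator fun _ => w (D m) := by
    funext x
    simp [stepInterp, Finset.sum_apply, Set.indicator_apply]
  rw [e]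
  refine IntervalIntegrable.sum _ fun m _ => Integrable.intervalIntegrable ?_
  exact (integrable_indicator_iff measurableSet_Ioc).2 (integrableOn_const (by simp))

open MeasureTheory in
theorem intervalIntegrable_eval_mul_sub_stepInterp (k : ℕ) (G D : ℕ → ℝ)
    (g w : Polynomial ℝ) (a b : ℝ) :
    IntervalIntegrable
      (fun x => g.eval x * (w.eval x - stepInterp k G D (fun t => w.eval t) x)) volume a b :=
  ((w.continuous.intervalIntegrable a b).sub
    (intervalIntegrable_stepInterp k G D _ a b)).continuousOn_mul g.continuous.continuousOn

theorem SymmConfig.integral_even_pow_mul_affine {k : ℕ} (c : SymmConfig k) (i : ℕ)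
    (hi : Even i) (w : Polynomial ℝ) (hw : w.degree ≤ 1) :
    ∫ x in (-1 : ℝ)..1,
      x ^ i * (w.eval x - stepInterp k c.G c.D (fun t => w.eval t) x) = 0 := by
  have he : ∀ t, w.eval t = w.coeff 0 + w.coeff 1 * t := fun t => by
    conv_lhs => rw [Polynomial.eq_X_add_C_of_degree_le_one hw]
    simp [add_comm]
  have h : ∫ x in (-1 : ℝ)..1,
        x ^ i * (w.eval x - stepInterp k c.G c.D (fun t => w.eval t) x) =
      ∫ x in (-1 : ℝ)..1,
        w.coeff 1 * (x ^ i * (x - stepInterp k c.G c.D (fun t => t) x)) := by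
    refine intervalIntegral.integral_congr_ae (Filter.Eventually.of_forall fun x hx => ?_)
    rw [Set.uIoc_of_le (by norm_num)] at hx
    simp only [he]
    rw [c.stepInterp_affine _ _ hx]
    ring
  rw [h, intervalIntegral.integral_const_mul, c.integral_even_pow_mul i hi, mul_zero]

theorem OrthCond.mono {k r s : ℕ} {c : SymmConfig k} (h : OrthCond k s c) (hrs : r ≤ s) :
    OrthCond k r c :=
  fun g w hg hw => h g w (hg.trans (by exact_mod_cast hrs)) hw

theorem OrthCond.succ {k r : ℕ} {c : SymmConfig k} (h : OrthCond k r c) (hr : Odd r) :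
    OrthCond k (r + 1) c := by
  intro g w hg hw
  have hlow : (g.erase (r + 1)).degree ≤ (r : ℕ) := by
    rw [Polynomial.degree_le_iff_coeff_zero] at hg ⊢
    intro n hn
    have hn : r < n := by exact_mod_cast hn
    rw [Polynomial.coeff_erase]
    split_ifs with e
    · rfl
    · exact hg n (by exact_mod_cast (show r + 1 < n by omega))
  have e := Polynomial.monomial_add_erase g (r + 1)
  have i1 := intervalIntegrable_eval_mul_sub_stepInterp k c.G c.D
    (Polynomial.monomial (r + 1) (g.coeff (r + 1))) w (-1) 1
  have i2 := intervalIntegrable_eval_mul_sub_stepInterp k c.G c.D (g.erase (r + 1)) w (-1) 1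
  rw [← e]
  simp only [Polynomial.eval_add, add_mul]
  rw [intervalIntegral.integral_add i1 i2, h _ w hlow hw, add_zero]
  simp only [Polynomial.eval_monomial, mul_assoc]
  rw [intervalIntegral.integral_const_mul,
    c.integral_even_pow_mul_affine (r + 1) hr.add_one w hw, mul_zero]

/-- for a symmetric configuration, `∫ x^i (x - Π id) = 0` for even `i`;
consequently the `k`-`r`- and `k`-`(r+1)`-order orthogonal conditions coincide for odd `r`. -/
theorem orthCond_even_moments_and_step (k : ℕ) (hk : 1 ≤ k) (c : SymmConfig k) :
    (∀ i : ℕ, Even i →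
      ∫ x in (-1:ℝ)..1, x ^ i * (x - stepInterp k c.G c.D (fun t => t) x) = 0) ∧
    (∀ r : ℕ, Odd r → 1 ≤ r → (OrthCond k r c ↔ OrthCond k (r + 1) c)) :=
  ⟨c.integral_even_pow_mul, fun r hr _ => ⟨fun h => h.succ hr, fun h => h.mono (by omega)⟩⟩
end

section
/- For every integer k ≥ 2 and every integer r with k−2 ≤ r ≤ 2(k−1), there exists a symmetric configuration on [−1,1] (i.e., dual points −1 < G₁ < … < G_k < 1 with G_j = −G_{k+1−j} and interpolation nodes −1 = D₀ < D₁ < … < D_k = 1 with D_j = −D_{k−j}) that satisfies the k-r-order orthogonal condition. -/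
open Polynomial

namespace GaussLegendre

/-- The linear functional `p ↦ ∫ x in -1..1, p(x)` on real polynomials. -/
noncomputable def integralLM : ℝ[X] →ₗ[ℝ] ℝ where
  toFun p := ∫ x in (-1 : ℝ)..1, p.eval x
  map_add' p q := by
    simp only [eval_add]
    exact intervalIntegral.integral_add (p.continuous.intervalIntegrable _ _)
      (q.continuous.intervalIntegrable _ _)
  map_smul' c p := by simp

theorem integralLM_apply (p : ℝ[X]) : integralLM p = ∫ x in (-1 : ℝ)..1, p.eval x := rfl

theorem integralLM_comp_neg_X (p : ℝ[X]) : integralLM (p.comp (-X)) = integralLM p := by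
  simp only [integralLM_apply, eval_comp, eval_neg, eval_X]
  rw [intervalIntegral.integral_comp_neg (fun x => p.eval x), neg_neg]

theorem integralLM_pos {p : ℝ[X]} (hp : p ≠ 0)
    (h : ∀ x ∈ Set.Icc (-1 : ℝ) 1, 0 ≤ p.eval x) : 0 < integralLM p := by
  obtain ⟨c, hc, hpc⟩ : ∃ c ∈ Set.Icc (-1 : ℝ) 1, ¬ p.IsRoot c := by
    by_contra! H
    exact (Set.Icc_infinite (by norm_num : (-1 : ℝ) < 1)) ((p.finite_setOfPred_isRoot hp).subset H)
  exact intervalIntegral.integral_pos (by norm_num) p.continuous.continuousOn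
    (fun x hx => h x (Set.Ioc_subset_Icc_self hx)) ⟨c, hc, (h c hc).lt_of_ne' hpc⟩

theorem eq_zero_of_integralLM_mul_self {p : ℝ[X]} (h : integralLM (p * p) = 0) : p = 0 := by
  by_contra hp
  refine (integralLM_pos (mul_self_ne_zero.2 hp) fun x _ => ?_).ne' h
  rw [eval_mul]
  exact mul_self_nonneg _

/-- There is a polynomial of degree `k` orthogonal to all polynomials of smaller degree. -/
theorem exists_orthogonal (k : ℕ) : ∃ p : ℝ[X], p.degree = k ∧
    ∀ q : ℝ[X], q.degree < k → integralLM (p * q) = 0 := by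
  let T : degreeLT ℝ (k + 1) →ₗ[ℝ] (Fin k → ℝ) :=
    LinearMap.pi fun i => integralLM ∘ₗ LinearMap.mulRight ℝ (X ^ (i : ℕ)) ∘ₗ Submodule.subtype _
  have hT : LinearMap.ker T ≠ ⊥ := by
    apply LinearMap.ker_ne_bot_of_finrank_lt
    rw [(degreeLTEquiv ℝ (k + 1)).finrank_eq]
    simp
  obtain ⟨⟨p, hpd⟩, hpT, hp0⟩ := Submodule.exists_mem_ne_zero_of_ne_bot hT
  have hp0 : p ≠ 0 := fun h => hp0 (Subtype.ext h)
  have horth : ∀ q : ℝ[X], q.degree < k → integralLM (p * q) = 0 := by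
    intro q hq
    rcases eq_or_ne q 0 with rfl | hq0
    · simp
    rw [q.as_sum_range_C_mul_X_pow' ((natDegree_lt_iff_degree_lt hq0).2 hq), Finset.mul_sum,
      map_sum]
    refine Finset.sum_eq_zero fun i hi => ?_
    have := congrFun (LinearMap.mem_ker.1 hpT) ⟨i, Finset.mem_range.1 hi⟩
    have h2 : integralLM (p * X ^ i) = 0 := this
    rw [mul_left_comm, ← smul_eq_C_mul, map_smul, h2, smul_zero]
  refine ⟨p, le_antisymm ?_ ?_, horth⟩
  · rw [mem_degreeLT] at hpd
    exact Order.le_of_lt_succ hpd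
  · by_contra! h
    exact hp0 (eq_zero_of_integralLM_mul_self (horth p h))

section Orthogonal

variable {k : ℕ} {p : ℝ[X]} (hk : p.degree = k)
  (horth : ∀ q : ℝ[X], q.degree < k → integralLM (p * q) = 0)
include hk horth

theorem not_eq_mul_of_nonneg {d h : ℝ[X]} (hp : p = d * h) (hd : 0 < d.degree)
    (hnn : ∀ x ∈ Set.Icc (-1 : ℝ) 1, 0 ≤ d.eval x) : False := by
  have hp0 : p ≠ 0 := by rintro rfl; simp at hk
  have hd0 : d ≠ 0 := by rintro rfl; simp at hd
  have hh0 : h ≠ 0 := by rintro rfl; simp [hp0] at hp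
  have hlt : h.degree < k := by
    rw [← hk, hp, degree_mul, degree_eq_natDegree hd0, degree_eq_natDegree hh0]
    rw [degree_eq_natDegree hd0] at hd
    norm_cast at hd ⊢
    omega
  refine (integralLM_pos (p := p * h) (mul_ne_zero hp0 hh0) fun x hx => ?_).ne' (horth h hlt)
  rw [hp, eval_mul, eval_mul, mul_assoc]
  exact mul_nonneg (hnn x hx) (mul_self_nonneg _)

theorem root_mem_Ioo {a : ℝ} (ha : p.IsRoot a) : a ∈ Set.Ioo (-1 : ℝ) 1 := by
  obtain ⟨h, hp⟩ := dvd_iff_isRoot.2 ha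
  constructor
  · by_contra! hle
    refine not_eq_mul_of_nonneg hk horth hp (by simp) fun x hx => ?_
    simp only [eval_sub, eval_X, eval_C]
    linarith [hx.1]
  · by_contra! hle
    refine not_eq_mul_of_nonneg hk horth (d := -(X - C a)) (h := -h) (by rw [hp]; ring)
      (by rw [degree_neg]; simp) fun x hx => ?_
    simp only [eval_sub, eval_X, eval_C, eval_neg]
    linarith [hx.2]

theorem splits_of_orthogonal : p.Splits := by
  have hp0 : p ≠ 0 := by rintro rfl; simp at hk
  obtain ⟨u, hu⟩ := UniqueFactorizationMonoid.factors_prod hp0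
  rw [← hu]
  refine (Splits.multisetProd fun g hgm => Splits.of_degree_eq_one ?_).mul u.isUnit.splits
  have hg := UniqueFactorizationMonoid.irreducible_of_factor g hgm
  have hgp := UniqueFactorizationMonoid.dvd_of_mem_factors hgm
  obtain ⟨z, hz⟩ := Complex.exists_root (f := g.map (algebraMap ℝ ℂ))
    (by rw [degree_map]; exact degree_pos_of_irreducible hg)
  have hz' : aeval z g = 0 := by
    rwa [IsRoot.def, eval_map_algebraMap] at hz
  by_cases him : z.im = 0
  · have hzr : z = (z.re : ℂ) := Complex.ext rfl (by simp [him])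
    rw [hzr] at hz'
    have : g.IsRoot z.re := by
      have := (aeval_algebraMap_apply ℂ z.re g).symm.trans hz'
      simpa using this
    exact degree_eq_one_of_irreducible_of_root hg this
  · obtain ⟨h, hp⟩ := (quadratic_dvd_of_aeval_eq_zero_im_ne_zero g hz' him).trans hgp
    have hdeg : (X ^ 2 - C (2 * z.re) * X + C (‖z‖ ^ 2) : ℝ[X]).degree = 2 := by
      compute_degree!
    refine (not_eq_mul_of_nonneg hk horth hp (by rw [hdeg]; norm_num) fun x _ => ?_).elim
    simp only [eval_add, eval_sub, eval_mul, eval_pow, eval_X, eval_C]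
    rw [← Complex.normSq_eq_norm_sq, Complex.normSq_apply]
    nlinarith [sq_nonneg (x - z.re), sq_nonneg z.im]

theorem card_roots_toFinset : p.roots.toFinset.card = k := by
  have hp0 : p ≠ 0 := by rintro rfl; simp at hk
  have hnd : p.roots.Nodup := by
    rw [Multiset.nodup_iff_count_le_one]
    intro a
    by_contra! h
    rw [count_roots] at h
    obtain ⟨q, hq⟩ := (le_rootMultiplicity_iff hp0).1 (show 2 ≤ rootMultiplicity a p from h)
    refine not_eq_mul_of_nonneg hk horth hq (by simp) fun x _ => ?_
    rw [eval_pow]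
    exact sq_nonneg _
  rw [Multiset.toFinset_card_of_nodup hnd,
    splits_iff_card_roots.1 (splits_of_orthogonal hk horth), natDegree_eq_of_degree_eq_some hk]

theorem isRoot_neg {a : ℝ} (ha : p.IsRoot a) : p.IsRoot (-a) := by
  have hp0 : p ≠ 0 := by rintro rfl; simp at hk
  set p' := p.comp (-X) with hp'
  have hdeg' : p'.degree ≤ k := by
    apply degree_le_of_natDegree_le
    rw [hp', natDegree_comp, natDegree_neg, natDegree_X, mul_one,
      natDegree_eq_of_degree_eq_some hk]
  have horth' : ∀ q : ℝ[X], q.degree < k → integralLM (p' * q) = 0 := by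
    intro q hq
    have h1 : p' * q = (p * q.comp (-X)).comp (-X) := by
      rw [mul_comp, comp_assoc]
      simp [hp']
    rw [h1, integralLM_comp_neg_X]
    apply horth
    by_cases hq0 : q = 0
    · simp [hq0]
    · rw [← natDegree_lt_iff_degree_lt hq0] at hq
      refine lt_of_le_of_lt degree_le_natDegree ?_
      rw [natDegree_comp, natDegree_neg, natDegree_X, mul_one]
      exact_mod_cast hq
  have hc : p.coeff k ≠ 0 := by
    rw [← natDegree_eq_of_degree_eq_some hk]
    exact leadingCoeff_ne_zero.2 hp0
  set r := p.coeff k • p' - p'.coeff k • p with hr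
  have hrdeg : r.degree < k := by
    refine (degree_lt_iff_coeff_zero _ _).2 fun m hm => ?_
    rcases hm.eq_or_lt with rfl | hm
    · simp [hr, mul_comm]
    · have h1 : p.coeff m = 0 := coeff_eq_zero_of_degree_lt (hk ▸ by exact_mod_cast hm)
      have h2 : p'.coeff m = 0 :=
        coeff_eq_zero_of_degree_lt (hdeg'.trans_lt (by exact_mod_cast hm))
      simp [hr, h1, h2]
  have hr0 : r = 0 := by
    apply eq_zero_of_integralLM_mul_self
    conv_lhs => rw [hr]
    rw [sub_mul, smul_mul_assoc, smul_mul_assoc, map_sub, map_smul, map_smul, horth r hrdeg,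
      horth' r hrdeg]
    simp
  have := congrArg (eval a) hr0
  simp only [hr, hp', eval_sub, eval_smul, eval_comp, eval_neg, eval_X, ha.eq_zero, smul_eq_mul,
    mul_zero, sub_zero, eval_zero, mul_eq_zero, hc, false_or] at this
  exact this

theorem integralLM_eq_sum {x : Fin k → ℝ} (hx : Function.Injective x)
    (hroot : ∀ i, p.IsRoot (x i)) {F : ℝ[X]} (hF : F.degree < (2 * k : ℕ)) :
    integralLM F =
      ∑ i, integralLM (Lagrange.basis Finset.univ x i) * F.eval (x i) := by
  have hp0 : p ≠ 0 := by rintro rfl; simp at hk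
  have hdiv : p * (F / p) + F % p = F := EuclideanDomain.div_add_mod F p
  have hmod : (F % p).degree < k := hk ▸ degree_mod_lt F hp0
  have hq : (F / p).degree < k := by
    by_cases hlt : p.degree ≤ F.degree
    · have h := degree_add_div hp0 hlt
      by_cases hq0 : F / p = 0
      · rw [hq0, degree_zero]; exact WithBot.bot_lt_coe _
      · rw [← h, hk, degree_eq_natDegree hq0] at hF
        rw [degree_eq_natDegree hq0]
        norm_cast at hF ⊢
        omega
    · rw [(Polynomial.div_eq_zero_iff hp0).2 (not_le.1 hlt), degree_zero]
      exact WithBot.bot_lt_coe _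
  have hev : ∀ i, (F % p).eval (x i) = F.eval (x i) := by
    intro i
    conv_rhs => rw [← hdiv]
    simp [(hroot i).eq_zero]
  have hint := Lagrange.eq_interpolate (s := Finset.univ) (v := x) hx.injOn (f := F % p)
    (by simpa using hmod)
  rw [← hdiv, map_add, horth _ hq, zero_add, hdiv, hint, Lagrange.interpolate_apply, map_sum]
  refine Finset.sum_congr rfl fun i _ => ?_
  rw [hev, ← smul_eq_C_mul, map_smul, smul_eq_mul, mul_comm]

end Orthogonal

/-- Gauss–Legendre quadrature: symmetric nodes in `(-1, 1)` with symmetric positive weights,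
exact on polynomials of degree less than `2 * k`. -/
theorem exists_quadrature (k : ℕ) : ∃ x w : Fin k → ℝ, StrictMono x ∧
    (∀ i, x i ∈ Set.Ioo (-1 : ℝ) 1) ∧ (∀ i, x i.rev = -x i) ∧ (∀ i, 0 < w i) ∧
    (∀ i, w i.rev = w i) ∧
    ∀ F : ℝ[X], F.degree < (2 * k : ℕ) → integralLM F = ∑ i, w i * F.eval (x i) := by
  obtain ⟨p, hk, horth⟩ := exists_orthogonal k
  have hp0 : p ≠ 0 := by rintro rfl; simp at hk
  have hcard := card_roots_toFinset hk horth
  set x := p.roots.toFinset.orderEmbOfFin hcard with hx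
  have hxm : StrictMono x := x.strictMono
  have hmem : ∀ a, a ∈ p.roots.toFinset ↔ p.IsRoot a := by
    intro a; rw [Multiset.mem_toFinset, mem_roots hp0]
  have hroot : ∀ i, p.IsRoot (x i) := fun i =>
    (hmem _).1 (Finset.orderEmbOfFin_mem _ hcard i)
  have hquad : ∀ F : ℝ[X], F.degree < (2 * k : ℕ) → integralLM F =
      ∑ i, integralLM (Lagrange.basis Finset.univ x i) * F.eval (x i) := fun F hF =>
    integralLM_eq_sum hk horth hxm.injective hroot hF
  have hrev : ∀ i, x i.rev = -x i := by
    have hm : StrictMono fun i : Fin k => -x i.rev := fun i j hij =>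
      neg_lt_neg (hxm (Fin.rev_lt_rev.2 hij))
    have := Finset.orderEmbOfFin_unique hcard (f := fun i : Fin k => -x i.rev)
      (fun i => (hmem _).2 (isRoot_neg hk horth (hroot _))) hm
    intro i
    have h := congrFun this i
    simp only [← hx] at h
    linarith
  have hself : ∀ i, (Lagrange.basis Finset.univ x i).eval (x i) = 1 := fun i =>
    Lagrange.eval_basis_self hxm.injective.injOn (Finset.mem_univ i)
  have hne : ∀ i j, i ≠ j → (Lagrange.basis Finset.univ x i).eval (x j) = 0 := fun i j hij =>
    Lagrange.eval_basis_of_ne hij (Finset.mem_univ j)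
  have hnat : ∀ i, (Lagrange.basis Finset.univ x i).natDegree = k - 1 := fun i => by
    simpa using Lagrange.natDegree_basis hxm.injective.injOn (Finset.mem_univ i)
  refine ⟨x, fun i => integralLM (Lagrange.basis Finset.univ x i), hxm,
    fun i => root_mem_Ioo hk horth (hroot i), hrev, fun i => ?_, fun i => ?_, hquad⟩
  · have hi := i.isLt
    have h0 : Lagrange.basis Finset.univ x i ≠ 0 :=
      Lagrange.basis_ne_zero hxm.injective.injOn (Finset.mem_univ i)
    have h := hquad (Lagrange.basis Finset.univ x i * Lagrange.basis Finset.univ x i) (by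
      rw [← natDegree_lt_iff_degree_lt (mul_ne_zero h0 h0), natDegree_mul h0 h0, hnat]
      omega)
    rw [Finset.sum_eq_single i (fun j _ hj => by simp [hne i j hj.symm])
      (fun h => (h (Finset.mem_univ i)).elim), eval_mul, hself, mul_one, mul_one] at h
    refine lt_of_lt_of_eq ?_ h
    refine integralLM_pos (mul_ne_zero h0 h0) fun t _ => ?_
    rw [eval_mul]
    exact mul_self_nonneg _
  · have hi := i.isLt
    have h := hquad ((Lagrange.basis Finset.univ x i).comp (-X)) (by
      refine lt_of_le_of_lt degree_le_natDegree ?_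
      rw [natDegree_comp, hnat, natDegree_neg, natDegree_X]
      norm_cast
      omega)
    rw [integralLM_comp_neg_X, Finset.sum_eq_single i.rev] at h
    · simp only [eval_comp, eval_neg, eval_X, hrev, neg_neg, hself, mul_one] at h
      exact h.symm
    · intro j _ hj
      have hj' : i ≠ j.rev := fun h => hj (by rw [h, Fin.rev_rev])
      simp only [eval_comp, eval_neg, eval_X, ← hrev, hne i _ hj', mul_zero]
    · exact fun h => (h (Finset.mem_univ _)).elim

end GaussLegendre

theorem Polynomial.exists_derivative_eq {n : ℕ} {g : ℝ[X]} (hg : g.degree ≤ n) :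
    ∃ F : ℝ[X], derivative F = g ∧ F.degree ≤ (n + 1 : ℕ) := by
  refine ⟨∑ i ∈ Finset.range (n + 1), C (g.coeff i / (i + 1)) * X ^ (i + 1), ?_, ?_⟩
  · conv_rhs => rw [g.as_sum_range_C_mul_X_pow' (Nat.lt_succ_of_le (natDegree_le_of_degree_le hg))]
    rw [derivative_sum]
    refine Finset.sum_congr rfl fun i _ => ?_
    have : (i : ℝ) + 1 ≠ 0 := by positivity
    rw [derivative_C_mul_X_pow]
    simp [this]
  · refine (degree_sum_le _ _).trans
      (Finset.sup_le fun i hi => (degree_C_mul_X_pow_le _ _).trans ?_)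
    have := Finset.mem_range.1 hi
    norm_cast

theorem sum_range_mul_sub_eq (d f : ℕ → ℝ) (n : ℕ) :
    ∑ m ∈ Finset.range (n + 1), d m * (f (m + 1) - f m) =
      d n * f (n + 1) - d 0 * f 0 - ∑ j ∈ Finset.range n, (d (j + 1) - d j) * f (j + 1) := by
  induction n with
  | zero => simp; ring
  | succ n ih => rw [Finset.sum_range_succ, ih, Finset.sum_range_succ]; ring

namespace SymmConfig

variable {k : ℕ} (c : SymmConfig k)

theorem G_le {i j : ℕ} (hij : i ≤ j) (hj : j ≤ k + 1) : c.G i ≤ c.G j := by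
  induction j, hij using Nat.le_induction with
  | base => rfl
  | succ j _ ih => exact (ih (by omega)).trans (c.G_mono j (by omega)).le

theorem stepInterp_eq (w : ℝ → ℝ) {m : ℕ} (hm : m ≤ k) {x : ℝ}
    (hx : x ∈ Set.Ioc (c.G m) (c.G (m + 1))) : stepInterp k c.G c.D w x = w (c.D m) := by
  rw [stepInterp, Finset.sum_eq_single m, if_pos hx]
  · intro j hj hjm
    rw [if_neg]
    rintro ⟨h1, h2⟩
    have hj := Finset.mem_range.1 hj
    rcases lt_or_gt_of_ne hjm with h | h
    · exact (h2.trans (c.G_le h (by omega))).not_gt hx.1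
    · exact (hx.2.trans (c.G_le h (by omega))).not_gt h1
  · intro h
    exact (h (Finset.mem_range.2 (by omega))).elim

theorem integral_mul_sub_stepInterp (g : ℝ[X]) (w : ℝ → ℝ) (hw : Continuous w) :
    ∫ x in (-1 : ℝ)..1, g.eval x * (w x - stepInterp k c.G c.D w x) =
      (∫ x in (-1 : ℝ)..1, g.eval x * w x) -
        ∑ m ∈ Finset.range (k + 1), w (c.D m) * ∫ x in c.G m..c.G (m + 1), g.eval x := by
  have hgw : Continuous fun x => g.eval x * w x := g.continuous.mul hw
  have hEq : ∀ m ≤ k, Set.EqOn (fun x => g.eval x * w x - w (c.D m) * g.eval x)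
      (fun x => g.eval x * (w x - stepInterp k c.G c.D w x))
      (Set.uIoc (c.G m) (c.G (m + 1))) := by
    intro m hm x hx
    rw [Set.uIoc_of_le (c.G_mono m hm).le] at hx
    simp only [c.stepInterp_eq w hm hx]
    ring
  have hint : ∀ m, IntervalIntegrable (fun x => g.eval x * w x - w (c.D m) * g.eval x)
      MeasureTheory.volume (c.G m) (c.G (m + 1)) := fun m =>
    (hgw.sub (continuous_const.mul g.continuous)).intervalIntegrable _ _
  rw [← c.G_zero, ← c.G_last, ← intervalIntegral.sum_integral_adjacent_intervals
    (fun m hm => (hint m).congr (hEq m (by omega))),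
    ← intervalIntegral.sum_integral_adjacent_intervals
    (fun m _ => hgw.intervalIntegrable _ _), ← Finset.sum_sub_distrib]
  refine Finset.sum_congr rfl fun m hm => ?_
  rw [← intervalIntegral.integral_const_mul, ← intervalIntegral.integral_sub
    (hgw.intervalIntegrable _ _)
    (by apply Continuous.intervalIntegrable; fun_prop)]
  exact (intervalIntegral.integral_congr_ae (Filter.Eventually.of_forall
    fun x hx => hEq m (Nat.lt_succ_iff.1 (Finset.mem_range.1 hm)) hx)).symm

/-- The orthogonality condition follows from exactness of the quadrature rule whose nodes are the
dual points and whose weights are the gaps between interpolation nodes. -/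
theorem orthCond_of_quadrature {r : ℕ}
    (h : ∀ F : ℝ[X], F.degree ≤ (r + 1 : ℕ) → ∫ x in (-1 : ℝ)..1, F.eval x =
      ∑ j ∈ Finset.range k, (c.D (j + 1) - c.D j) * F.eval (c.G (j + 1))) :
    OrthCond k r c := by
  intro g w hg hw
  obtain ⟨F, rfl, hF⟩ := exists_derivative_eq hg
  obtain ⟨a, b, rfl⟩ : ∃ a b, w = C a * X + C b :=
    ⟨_, _, eq_X_add_C_of_degree_le_one hw⟩
  have hFTC : ∀ (P : ℝ[X]) (s t : ℝ), ∫ x in s..t, (derivative P).eval x = P.eval t - P.eval s :=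
    fun P s t => intervalIntegral.integral_eq_sub_of_hasDerivAt (fun x _ => P.hasDerivAt x)
      ((derivative P).continuous.intervalIntegrable _ _)
  have hparts := hFTC (F * (C a * X + C b)) (-1) 1
  simp only [derivative_mul, derivative_add, derivative_C, derivative_X, eval_add, eval_mul,
    zero_mul, zero_add, mul_one, add_zero, eval_C, eval_X] at hparts
  rw [intervalIntegral.integral_add
    (by apply Continuous.intervalIntegrable; fun_prop)
    (by apply Continuous.intervalIntegrable; fun_prop),
    intervalIntegral.integral_mul_const, h F hF] at hparts
  rw [c.integral_mul_sub_stepInterp _ _ (Polynomial.continuous _)]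
  simp only [hFTC, eval_add, eval_mul, eval_C, eval_X]
  rw [sum_range_mul_sub_eq (fun m => a * c.D m + b) (fun m => F.eval (c.G m))]
  have hsum : ∑ j ∈ Finset.range k, (a * c.D (j + 1) + b - (a * c.D j + b)) * F.eval (c.G (j + 1))
      = (∑ j ∈ Finset.range k, (c.D (j + 1) - c.D j) * F.eval (c.G (j + 1))) * a := by
    rw [Finset.sum_mul]
    exact Finset.sum_congr rfl fun j _ => by ring
  rw [hsum, c.D_last, c.G_last, c.D_zero, c.G_zero]
  linarith

end SymmConfig

/-- for every `k ≥ 2` and `k - 2 ≤ r ≤ 2(k-1)` there is a symmetric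
configuration satisfying the `k`-`r`-order orthogonal condition. -/
theorem exists_symmConfig_orthCond (k : ℕ) (hk : 2 ≤ k) (r : ℕ)
    (hr1 : k - 2 ≤ r) (hr2 : r ≤ 2 * (k - 1)) :
    ∃ c : SymmConfig k, OrthCond k r c := by
  obtain ⟨x, w, hxm, hx, hxrev, hw, hwrev, hquad⟩ := GaussLegendre.exists_quadrature k
  set x' : ℕ → ℝ := fun j => if h : j < k then x ⟨j, h⟩ else 1 with hx'
  set w' : ℕ → ℝ := fun j => if h : j < k then w ⟨j, h⟩ else 0 with hw'
  have hsumw : ∑ j ∈ Finset.range k, w' j = 2 := by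
    have h := hquad 1 (by rw [degree_one]; exact_mod_cast (by omega : 0 < 2 * k))
    rw [GaussLegendre.integralLM_apply] at h
    simp only [eval_one, intervalIntegral.integral_const, mul_one] at h
    rw [Finset.sum_range]
    simp only [hw', Fin.is_lt, dite_true, Fin.eta]
    rw [← h]
    norm_num
  have hw'rev : ∀ j < k, w' (k - 1 - j) = w' j := by
    intro j hj
    have h := hwrev ⟨j, hj⟩
    simp only [hw', hj, dite_true, show k - 1 - j < k by omega]
    rw [← h]
    congr 1
    ext
    simp [Fin.val_rev]
    omega
  let c : SymmConfig k :=
    { G := fun j => if j = 0 then -1 else x' (j - 1)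
      D := fun j => -1 + ∑ i ∈ Finset.range j, w' i
      G_zero := by simp
      G_last := by simp [hx']
      G_mono := by
        intro j hj
        rcases Nat.eq_zero_or_pos j with rfl | hj0
        · simpa [hx', show 0 < k by omega] using (hx _).1
        · rcases hj.eq_or_lt with rfl | hlt
          · simpa [hx', hj0.ne', show j - 1 < j by omega] using (hx _).2
          · simp only [hj0.ne', hx', hlt, show j - 1 < k by omega, if_false, dite_true,
              Nat.add_sub_cancel, Nat.succ_ne_zero]
            exact hxm (by simp only [Fin.mk_lt_mk]; omega)
      G_symm := by
        intro j hj1 hjk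
        have h := hxrev ⟨j - 1, by omega⟩
        simp only [show j ≠ 0 by omega, show k + 1 - j ≠ 0 by omega, if_false, hx',
          show j - 1 < k by omega, show k + 1 - j - 1 < k by omega, dite_true]
        rw [eq_neg_iff_add_eq_zero, ← eq_neg_iff_add_eq_zero.1 h, add_comm]
        congr 2
        ext
        simp [Fin.val_rev]
        omega
      D_zero := by simp
      D_last := by rw [hsumw]; norm_num
      D_mono := by
        intro j hj
        rw [Finset.sum_range_succ]
        have : 0 < w' j := by simpa [hw', hj] using hw _
        linarith
      D_symm := by
        intro j hj
        have h1 : ∑ i ∈ Finset.range (k - j), w' i = ∑ i ∈ Finset.Ico j k, w' i := by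
          rw [Finset.sum_Ico_eq_sum_range, ← Finset.sum_range_reflect]
          refine Finset.sum_congr rfl fun i hi => ?_
          have := Finset.mem_range.1 hi
          rw [← hw'rev _ (by omega)]
          congr 1
          omega
        have h2 := Finset.sum_range_add_sum_Ico w' hj
        rw [h1]
        linarith }
  refine ⟨c, c.orthCond_of_quadrature fun F hF => ?_⟩
  rw [← GaussLegendre.integralLM_apply, hquad F (hF.trans_lt (by norm_cast; omega)),
    Finset.sum_range]
  refine Finset.sum_congr rfl fun i _ => ?_
  simp [c, hx', hw', Finset.sum_range_succ]
end
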